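/- Let k be a positive integer and let A : ℝ → ℝ_{≥0} be a probability density function such that ∫_ℝ z^t A(z) dz = ∫_ℝ z^t φ(z) dz for every integer 1 ≤ t ≤ k, and such that χ²(A, N(0,1)) := ∫_ℝ A(z)²/φ(z) dz − 1 is finite. For a unit vector u ∈ ℝ^d, let P_u denote the probability density on ℝ^d given by P_u(x) = A(⟨u, x⟩)·exp(−‖x − ⟨u, x⟩u‖²/2)/(2π)^{(d−1)/2}. Then for all unit vectors u, v ∈ ℝ^d, |∫_{ℝ^d} P_u(x)·P_v(x)/φ_d(x) dx − 1| ≤ |⟨u, v⟩|^{k+1} · χ²(A, N(0,1)). -/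

import Mathlib

open MeasureTheory RealInnerProductSpace Real

/-- The standard Gaussian density on `ℝ`. -/
noncomputable def gaussDensity (z : ℝ) : ℝ := Real.exp (-z ^ 2 / 2) / Real.sqrt (2 * π)

/-- The standard Gaussian density on `ℝ^d`. -/
noncomputable def gaussDensityPi (d : ℕ) (x : EuclideanSpace ℝ (Fin d)) : ℝ :=
  Real.exp (-‖x‖ ^ 2 / 2) / (2 * π) ^ ((d : ℝ) / 2)

/-- The hidden-direction density `P_u` on `ℝ^d`: along the direction `u` it follows the
density `A`, and on the orthogonal complement it is standard Gaussian. -/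
noncomputable def hiddenDirDensity (A : ℝ → ℝ) {d : ℕ} (u x : EuclideanSpace ℝ (Fin d)) :
    ℝ :=
  A ⟪u, x⟫ * Real.exp (-‖x - ⟪u, x⟫ • u‖ ^ 2 / 2) / (2 * π) ^ (((d : ℝ) - 1) / 2)

section GaussianCorrelation

open ProbabilityTheory Polynomial

/-! ### Polynomials and the one-dimensional Gaussian measure -/

section OneDim

lemma integrable_polynomial_gaussianReal (p : ℝ[X]) :
    Integrable (fun x ↦ p.eval x) (gaussianReal 0 1) := by
  simp_rw [eval_eq_sum_range]
  refine integrable_finsetSum _ fun i _ ↦ Integrable.const_mul ?_ _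
  exact integrable_pow_of_integrable_exp_mul one_ne_zero
    (integrable_exp_mul_gaussianReal 1) (integrable_exp_mul_gaussianReal (-1)) i

lemma memLp_two_polynomial_gaussianReal (p : ℝ[X]) :
    MemLp (fun x ↦ p.eval x) 2 (gaussianReal 0 1) := by
  rw [memLp_two_iff_integrable_sq p.continuous.aestronglyMeasurable]
  refine (integrable_polynomial_gaussianReal (p * p)).congr
    (Filter.Eventually.of_forall fun x ↦ ?_)
  simp [sq]

lemma integrable_gaussianReal_iff {f : ℝ → ℝ} :
    Integrable f (gaussianReal 0 1) ↔ Integrable fun x ↦ gaussianPDFReal 0 1 x * f x := by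
  rw [gaussianReal_of_var_ne_zero _ one_ne_zero,
    integrable_withDensity_iff_integrable_smul' (measurable_gaussianPDF 0 1)
      (Filter.Eventually.of_forall fun _ ↦ gaussianPDF_lt_top)]
  simp [toReal_gaussianPDF]

lemma hasDerivAt_gaussianPDFReal (x : ℝ) :
    HasDerivAt (gaussianPDFReal 0 1) (-(x * gaussianPDFReal 0 1 x)) x := by
  have h : HasDerivAt (fun y : ℝ ↦ -y ^ 2 / 2) (-x) x := by
    convert! ((hasDerivAt_pow 2 x).neg.div_const 2) using 1
    simp; ring
  simp only [gaussianPDFReal_def, sub_zero, NNReal.coe_one, mul_one]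
  convert! (h.exp.const_mul (√(2 * π))⁻¹) using 1
  ring

/-- Stein's identity for polynomials. -/
lemma integral_mul_polynomial_gaussianReal (p : ℝ[X]) :
    ∫ x, x * p.eval x ∂gaussianReal 0 1 = ∫ x, p.derivative.eval x ∂gaussianReal 0 1 := by
  simp_rw [integral_gaussianReal_eq_integral_smul (one_ne_zero : (1 : NNReal) ≠ 0), smul_eq_mul]
  have key := integral_mul_deriv_eq_deriv_mul_of_integrable
    (u := fun x ↦ p.eval x) (v := gaussianPDFReal 0 1) (u' := fun x ↦ p.derivative.eval x)
    (v' := fun x ↦ -(x * gaussianPDFReal 0 1 x))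
    (fun x _ ↦ p.hasDerivAt x) (fun x _ ↦ hasDerivAt_gaussianPDFReal x) ?_ ?_ ?_
  · simp only [mul_neg, integral_neg, neg_inj] at key
    rw [show (fun x ↦ gaussianPDFReal 0 1 x * (x * p.eval x)) =
      fun x ↦ p.eval x * (x * gaussianPDFReal 0 1 x) by ext; ring, key]
    simp_rw [mul_comm]
  · have := (integrable_gaussianReal_iff.1 (integrable_polynomial_gaussianReal (X * p))).neg
    refine this.congr (Filter.Eventually.of_forall fun x ↦ ?_)
    simp; ring
  · refine (integrable_gaussianReal_iff.1
      (integrable_polynomial_gaussianReal p.derivative)).congr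
      (Filter.Eventually.of_forall fun x ↦ ?_)
    simp; ring
  · refine (integrable_gaussianReal_iff.1
      (integrable_polynomial_gaussianReal p)).congr
      (Filter.Eventually.of_forall fun x ↦ ?_)
    simp; ring

/-- The moments determine a square-integrable function for the Gaussian measure. -/
lemma ae_eq_zero_of_integral_pow_mul_gaussianReal_eq_zero {f : ℝ → ℝ}
    (hf : MemLp f 2 (gaussianReal 0 1)) (h : ∀ n : ℕ, ∫ x, x ^ n * f x ∂gaussianReal 0 1 = 0) :
    f =ᵐ[gaussianReal 0 1] 0 := by
  have hfi : Integrable f (gaussianReal 0 1) := hf.integrable one_le_two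
  have hexp (t : ℝ) : Integrable (fun x ↦ Real.exp (|t * x|) * |f x|) (gaussianReal 0 1) := by
    refine MemLp.integrable_mul (p := 2) (q := 2) ?_ hf.abs
    rw [memLp_two_iff_integrable_sq (by fun_prop)]
    refine (integrable_exp_mul_abs (integrable_exp_mul_gaussianReal (2 * |t|))
      (integrable_exp_mul_gaussianReal (-(2 * |t|)))).congr
      (Filter.Eventually.of_forall fun x ↦ ?_)
    simp only [← Real.exp_nat_mul, abs_mul]
    push_cast
    ring_nf
  have hchar (t : ℝ) : ∫ x, Complex.exp (t * x * Complex.I) * f x ∂gaussianReal 0 1 = 0 := by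
    have hs := hasSum_integral_of_dominated_convergence (μ := gaussianReal 0 1)
      (F := fun (n : ℕ) (x : ℝ) ↦ (t * x * Complex.I) ^ n / n.factorial * (f x : ℂ))
      (f := fun x : ℝ ↦ Complex.exp (t * x * Complex.I) * f x)
      (bound := fun n x ↦ |t * x| ^ n / n.factorial * |f x|) ?_ ?_ ?_ ?_ ?_
    · refine hs.unique ?_
      convert! hasSum_zero (α := ℂ) (β := ℕ) with n
      have : ∀ x : ℝ, ((t : ℂ) * x * Complex.I) ^ n / n.factorial * (f x : ℂ) =
          ((t * Complex.I) ^ n / n.factorial) * ((x ^ n * f x : ℝ) : ℂ) := by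
        intro x; push_cast; ring
      simp_rw [this]
      rw [integral_const_mul, integral_complex_ofReal, h n]
      simp
    · intro n
      have := hf.1.aemeasurable
      exact AEMeasurable.aestronglyMeasurable (by fun_prop)
    · exact fun n ↦ Filter.Eventually.of_forall fun x ↦ by simp
    · exact Filter.Eventually.of_forall fun x ↦
        (NormedSpace.expSeries_div_hasSum_exp (|t * x|)).summable.mul_right _
    · refine (hexp t).congr (Filter.Eventually.of_forall fun x ↦ ?_)
      simp only
      rw [tsum_mul_right, (NormedSpace.expSeries_div_hasSum_exp (|t * x|)).tsum_eq,
        Real.exp_eq_exp_ℝ]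
    · refine Filter.Eventually.of_forall fun x ↦ ?_
      rw [Complex.exp_eq_exp_ℂ]
      exact (NormedSpace.expSeries_div_hasSum_exp ((t : ℂ) * x * Complex.I)).mul_right _
  have hfin1 := isFiniteMeasure_withDensity_ofReal hfi.2
  have hfin2 := isFiniteMeasure_withDensity_ofReal hfi.neg.2
  have hm := hf.1.aemeasurable
  have hInt (g : ℝ → ℝ) (hg : MemLp g 2 (gaussianReal 0 1)) (t : ℝ) : Integrable
      (fun x : ℝ ↦ (ENNReal.ofReal (g x)).toReal • Complex.exp (t * x * Complex.I))
      (gaussianReal 0 1) := by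
    have := hg.1.aemeasurable
    refine (hg.integrable one_le_two).mono (AEMeasurable.aestronglyMeasurable (by fun_prop))
      (Filter.Eventually.of_forall fun x ↦ ?_)
    rw [norm_smul, ← Complex.ofReal_mul, Complex.norm_exp_ofReal_mul_I, mul_one,
      ENNReal.toReal_ofReal', Real.norm_eq_abs, Real.norm_eq_abs, abs_of_nonneg (by positivity)]
    exact max_le (le_abs_self _) (abs_nonneg _)
  have heq : (gaussianReal 0 1).withDensity (fun x ↦ ENNReal.ofReal (f x)) =
      (gaussianReal 0 1).withDensity (fun x ↦ ENNReal.ofReal ((-f) x)) := by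
    refine Measure.ext_of_charFun (funext fun t ↦ ?_)
    rw [charFun_apply_real, charFun_apply_real, ← sub_eq_zero,
      integral_withDensity_eq_integral_toReal_smul₀ (by fun_prop) (by simp),
      integral_withDensity_eq_integral_toReal_smul₀ (by fun_prop) (by simp), ← integral_sub,
      ← hchar t]
    · congr with x
      rw [← sub_smul]
      have : (ENNReal.ofReal (f x)).toReal - (ENNReal.ofReal ((-f) x)).toReal = f x := by
        simp only [ENNReal.toReal_ofReal', Pi.neg_apply]
        exact max_zero_sub_max_neg_zero_eq_self (f x)
      rw [this, Complex.real_smul, mul_comm]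
    · exact hInt f hf t
    · exact hInt (-f) hf.neg t
  rw [withDensity_eq_iff_of_sigmaFinite (by fun_prop) (by fun_prop)] at heq
  filter_upwards [heq] with x hx
  have h1 := congrArg ENNReal.toReal hx
  simp only [ENNReal.toReal_ofReal', Pi.neg_apply] at h1
  have := max_zero_sub_max_neg_zero_eq_self (f x)
  simp; linarith

end OneDim

/-! ### Hermite polynomials -/

section Hermite

/-- The probabilists' Hermite polynomials with real coefficients. -/
noncomputable def realHermite (n : ℕ) : ℝ[X] := (hermite n).map (Int.castRingHom ℝ)

lemma realHermite_zero : realHermite 0 = 1 := by simp [realHermite]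

lemma realHermite_succ (n : ℕ) :
    realHermite (n + 1) = X * realHermite n - derivative (realHermite n) := by
  simp [realHermite, hermite_succ, derivative_map]

lemma monic_realHermite (n : ℕ) : (realHermite n).Monic := (hermite_monic n).map _

lemma natDegree_realHermite (n : ℕ) : (realHermite n).natDegree = n := by
  rw [realHermite, (hermite_monic n).natDegree_map, natDegree_hermite]

lemma iterate_derivative_realHermite_self (n : ℕ) :
    derivative^[n] (realHermite n) = C (n.factorial : ℝ) := by
  have h0 : (derivative^[n] (realHermite n)).natDegree ≤ 0 := by
    simpa [natDegree_realHermite] using natDegree_iterate_derivative (realHermite n) n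
  have hc : (realHermite n).coeff n = 1 := by
    simpa [natDegree_realHermite] using (monic_realHermite n).coeff_natDegree
  rw [eq_C_of_natDegree_le_zero h0, coeff_iterate_derivative]
  simp [hc, Nat.descFactorial_self]

lemma iterate_derivative_realHermite_of_lt {m n : ℕ} (h : n < m) :
    derivative^[m] (realHermite n) = 0 :=
  iterate_derivative_eq_zero (by rwa [natDegree_realHermite])

lemma span_range_realHermite : Submodule.span ℝ (Set.range realHermite) = ⊤ := by
  let S : Polynomial.Sequence ℝ := ⟨realHermite, fun n ↦ by
    rw [degree_eq_natDegree (monic_realHermite n).ne_zero, natDegree_realHermite]⟩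
  exact S.span fun n ↦ by
    change IsUnit (realHermite n).leadingCoeff
    simp [(monic_realHermite n).leadingCoeff]

end Hermite

/-! ### Pairs of correlated standard Gaussian variables -/

section Pair

/-- `U` and `V` are standard Gaussian variables satisfying the Stein identity of a Gaussian pair
with correlation `ρ` on polynomials. -/
structure IsSteinPair {Ω : Type*} [MeasurableSpace Ω] (P : Measure Ω) (U V : Ω → ℝ) (ρ : ℝ) :
    Prop where
  left : MeasurePreserving U P (gaussianReal 0 1)
  right : MeasurePreserving V P (gaussianReal 0 1)
  stein : ∀ p q : ℝ[X], ∫ ω, U ω * p.eval (U ω) * q.eval (V ω) ∂P =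
    ∫ ω, p.derivative.eval (U ω) * q.eval (V ω) ∂P
      + ρ * ∫ ω, p.eval (U ω) * q.derivative.eval (V ω) ∂P

variable {Ω : Type*} [MeasurableSpace Ω] {P : Measure Ω} {U V : Ω → ℝ} {ρ : ℝ}

lemma integrable_comp_mul_comp_polynomial (hU : MeasurePreserving U P (gaussianReal 0 1))
    (hV : MeasurePreserving V P (gaussianReal 0 1)) (p q : ℝ[X]) :
    Integrable (fun ω ↦ p.eval (U ω) * q.eval (V ω)) P :=
  MemLp.integrable_mul (p := 2) (q := 2)
    ((memLp_two_polynomial_gaussianReal p).comp_measurePreserving hU)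
    ((memLp_two_polynomial_gaussianReal q).comp_measurePreserving hV)

lemma isSteinPair_id : IsSteinPair (gaussianReal 0 1) id id 1 where
  left := MeasurePreserving.id _
  right := MeasurePreserving.id _
  stein p q := by
    have h := integral_mul_polynomial_gaussianReal (p * q)
    have hInt := integrable_comp_mul_comp_polynomial (MeasurePreserving.id (gaussianReal 0 1))
      (MeasurePreserving.id (gaussianReal 0 1))
    simp only [id] at hInt ⊢
    rw [one_mul, ← integral_add (hInt _ _) (hInt _ _)]
    simpa [mul_assoc] using h

lemma IsSteinPair.integral_realHermite_mul (h : IsSteinPair P U V ρ) (m : ℕ) (q : ℝ[X]) :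
    ∫ ω, (realHermite m).eval (U ω) * q.eval (V ω) ∂P =
      ρ ^ m * ∫ ω, (derivative^[m] q).eval (V ω) ∂P := by
  induction m generalizing q with
  | zero => simp [realHermite_zero]
  | succ m ih =>
    have e : ∀ ω, (realHermite (m + 1)).eval (U ω) * q.eval (V ω) =
        (X * realHermite m).eval (U ω) * q.eval (V ω)
          - (derivative (realHermite m)).eval (U ω) * q.eval (V ω) := by
      intro ω; rw [realHermite_succ, eval_sub, sub_mul]
    simp_rw [e]
    rw [integral_sub (integrable_comp_mul_comp_polynomial h.left h.right _ _)
      (integrable_comp_mul_comp_polynomial h.left h.right _ _)]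
    simp_rw [eval_mul, eval_X]
    rw [h.stein, ih, add_sub_cancel_left, Function.iterate_succ_apply]
    ring

lemma IsSteinPair.integral_realHermite_mul_realHermite [IsProbabilityMeasure P]
    (h : IsSteinPair P U V ρ) (h' : IsSteinPair P V U ρ) (m n : ℕ) :
    ∫ ω, (realHermite m).eval (U ω) * (realHermite n).eval (V ω) ∂P =
      if m = n then ρ ^ n * n.factorial else 0 := by
  rcases lt_trichotomy m n with hmn | rfl | hmn
  · simp_rw [mul_comm (eval (U _) _)]
    rw [h'.integral_realHermite_mul, iterate_derivative_realHermite_of_lt hmn, if_neg hmn.ne]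
    simp
  · rw [h.integral_realHermite_mul, iterate_derivative_realHermite_self]
    simp
  · rw [h.integral_realHermite_mul, iterate_derivative_realHermite_of_lt hmn, if_neg hmn.ne']
    simp

/-- The normalized Hermite functions in the Gaussian `L²` space. -/
noncomputable def hermiteLp (n : ℕ) : Lp ℝ 2 (gaussianReal 0 1) :=
  (√(n.factorial : ℝ))⁻¹ • (memLp_two_polynomial_gaussianReal (realHermite n)).toLp

lemma inner_compMeasurePreserving_toLp {f g : ℝ → ℝ} (hU : MeasurePreserving U P (gaussianReal 0 1))
    (hV : MeasurePreserving V P (gaussianReal 0 1)) (hf : MemLp f 2 (gaussianReal 0 1))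
    (hg : MemLp g 2 (gaussianReal 0 1)) :
    ⟪Lp.compMeasurePreservingₗᵢ ℝ U hU hf.toLp, Lp.compMeasurePreservingₗᵢ ℝ V hV hg.toLp⟫ =
      ∫ ω, f (U ω) * g (V ω) ∂P := by
  change ⟪Lp.compMeasurePreserving U hU hf.toLp, Lp.compMeasurePreserving V hV hg.toLp⟫ = _
  rw [Lp.toLp_compMeasurePreserving, Lp.toLp_compMeasurePreserving, L2.inner_def]
  refine integral_congr_ae ?_
  filter_upwards [(hf.comp_measurePreserving hU).coeFn_toLp,
    (hg.comp_measurePreserving hV).coeFn_toLp] with ω h1 h2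
  simp [h1, h2, mul_comm]

lemma inner_toLp {f g : ℝ → ℝ} (hf : MemLp f 2 (gaussianReal 0 1))
    (hg : MemLp g 2 (gaussianReal 0 1)) :
    ⟪hf.toLp, hg.toLp⟫ = ∫ x, f x * g x ∂gaussianReal 0 1 := by
  rw [L2.inner_def]
  refine integral_congr_ae ?_
  filter_upwards [hf.coeFn_toLp, hg.coeFn_toLp] with ω h1 h2
  simp [h1, h2, mul_comm]

lemma IsSteinPair.inner_hermiteLp [IsProbabilityMeasure P]
    (h : IsSteinPair P U V ρ) (h' : IsSteinPair P V U ρ) (m n : ℕ) :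
    ⟪Lp.compMeasurePreservingₗᵢ ℝ U h.left (hermiteLp m),
      Lp.compMeasurePreservingₗᵢ ℝ V h.right (hermiteLp n)⟫ = if m = n then ρ ^ n else 0 := by
  rw [hermiteLp, hermiteLp, map_smul, map_smul, real_inner_smul_left, real_inner_smul_right,
    inner_compMeasurePreserving_toLp, h.integral_realHermite_mul_realHermite h']
  split_ifs with hmn
  · subst hmn
    have : (0 : ℝ) < m.factorial := by positivity
    have h2 := Real.sq_sqrt this.le
    field_simp
    rw [h2]
    ring
  · simp

lemma orthonormal_hermiteLp : Orthonormal ℝ hermiteLp := by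
  rw [orthonormal_iff_ite]
  intro m n
  have h := isSteinPair_id.inner_hermiteLp isSteinPair_id m n
  rw [LinearIsometry.inner_map_map] at h
  simpa using h

lemma orthogonal_span_hermiteLp : (Submodule.span ℝ (Set.range hermiteLp))ᗮ = ⊥ := by
  rw [Submodule.eq_bot_iff]
  intro F hF
  have hFm : MemLp F 2 (gaussianReal 0 1) := Lp.memLp F
  have hInt (p : ℝ[X]) : Integrable (fun x ↦ p.eval x * F x) (gaussianReal 0 1) :=
    MemLp.integrable_mul (p := 2) (q := 2) (memLp_two_polynomial_gaussianReal p) hFm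
  have key (p : ℝ[X]) : ∫ x, p.eval x * F x ∂gaussianReal 0 1 = 0 := by
    have hp : p ∈ Submodule.span ℝ (Set.range realHermite) := by
      rw [span_range_realHermite]; trivial
    induction hp using Submodule.span_induction with
    | mem p hp =>
      obtain ⟨n, rfl⟩ := hp
      have h1 : ⟪hermiteLp n, F⟫ = 0 :=
        (Submodule.mem_orthogonal _ _).1 hF _ (Submodule.subset_span ⟨n, rfl⟩)
      rw [hermiteLp, real_inner_smul_left, ← Lp.toLp_coeFn F hFm, inner_toLp] at h1
      exact (mul_eq_zero.1 h1).resolve_left (by positivity)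
    | zero => simp
    | add p q _ _ hp hq =>
      simp_rw [eval_add, add_mul]
      rw [integral_add (hInt _) (hInt _), hp, hq, add_zero]
    | smul a p _ hp =>
      simp_rw [eval_smul, smul_eq_mul, mul_assoc]
      rw [integral_const_mul, hp, mul_zero]
  have h0 := ae_eq_zero_of_integral_pow_mul_gaussianReal_eq_zero hFm
    fun n ↦ by simpa using key (X ^ n)
  exact (Lp.eq_zero_iff_ae_eq_zero).2 h0

/-- A function orthogonal to all polynomials of degree at most `k` contracts by
`|ρ| ^ (k + 1)` under correlation `ρ`. -/
lemma IsSteinPair.abs_integral_mul_le [IsProbabilityMeasure P]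
    (hUV : IsSteinPair P U V ρ) (hVU : IsSteinPair P V U ρ) (hρ : |ρ| ≤ 1) {k : ℕ} {h : ℝ → ℝ}
    (hh : MemLp h 2 (gaussianReal 0 1))
    (hmom : ∀ t ≤ k, ∫ x, x ^ t * h x ∂gaussianReal 0 1 = 0) :
    |∫ ω, h (U ω) * h (V ω) ∂P| ≤ |ρ| ^ (k + 1) * ∫ x, h x ^ 2 ∂gaussianReal 0 1 := by
  let b := HilbertBasis.mkOfOrthogonalEqBot orthonormal_hermiteLp orthogonal_span_hermiteLp
  have hb : ∀ n, b n = hermiteLp n := fun n ↦ by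
    simp [b]
  let F := hh.toLp
  let c : ℕ → ℝ := fun n ↦ ⟪hermiteLp n, F⟫
  have hF : HasSum (fun n ↦ c n • hermiteLp n) F := by
    simpa [c, HilbertBasis.repr_apply_apply, hb] using b.hasSum_repr F
  let CU := (Lp.compMeasurePreservingₗᵢ (E := ℝ) (p := 2) ℝ U hUV.left)
  let CV := (Lp.compMeasurePreservingₗᵢ (E := ℝ) (p := 2) ℝ V hUV.right)
  have hc : ∀ n ≤ k, c n = 0 := by
    intro n hn
    have hInt (t : ℕ) : Integrable (fun x ↦ x ^ t * h x) (gaussianReal 0 1) := by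
      simpa [Pi.mul_def] using MemLp.integrable_mul (p := 2) (q := 2)
        (memLp_two_polynomial_gaussianReal (X ^ t)) hh
    simp only [c, F]
    rw [hermiteLp, real_inner_smul_left, inner_toLp]
    have e (x : ℝ) : (realHermite n).eval x * h x =
        ∑ i ∈ Finset.range (n + 1), (realHermite n).coeff i * (x ^ i * h x) := by
      rw [eval_eq_sum_range, natDegree_realHermite, Finset.sum_mul]
      simp_rw [mul_assoc]
    simp_rw [e]
    rw [integral_finsetSum _ fun i _ ↦ (hInt i).const_mul _, Finset.sum_eq_zero, mul_zero]
    intro i hi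
    rw [integral_const_mul, hmom i (by have := Finset.mem_range.1 hi; omega), mul_zero]
  have h1 (n : ℕ) : ⟪CU F, CV (hermiteLp n)⟫ = c n * ρ ^ n := by
    have hs := (hF.mapL CU.toContinuousLinearMap).mapL (innerSL ℝ (CV (hermiteLp n)))
    have hs' : HasSum (fun m ↦ if m = n then c n * ρ ^ n else 0) ⟪CU F, CV (hermiteLp n)⟫ := by
      rw [real_inner_comm]
      convert! hs using 2 with m
      rw [map_smul, map_smul, smul_eq_mul, innerSL_apply_apply, real_inner_comm]
      change _ = c m * ⟪CU (hermiteLp m), _⟫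
      rw [hUV.inner_hermiteLp hVU]
      split_ifs with hmn <;> simp [hmn]
    exact hs'.unique (hasSum_ite_eq n _)
  have h2 : HasSum (fun n ↦ c n ^ 2 * ρ ^ n) (∫ ω, h (U ω) * h (V ω) ∂P) := by
    have hs := (hF.mapL CV.toContinuousLinearMap).mapL (innerSL ℝ (CU F))
    convert! hs using 1
    · ext n
      rw [map_smul, map_smul, smul_eq_mul, innerSL_apply_apply]
      change _ = c n * ⟪CU F, CV (hermiteLp n)⟫
      rw [h1]; ring
    · exact (inner_compMeasurePreserving_toLp hUV.left hUV.right hh hh).symm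
  have h3 : HasSum (fun n ↦ c n ^ 2) (∫ x, h x ^ 2 ∂gaussianReal 0 1) := by
    have hs := hF.mapL (innerSL ℝ F)
    convert! hs using 1
    · ext n
      rw [map_smul, smul_eq_mul, innerSL_apply_apply, real_inner_comm, sq]
    · rw [innerSL_apply_apply, inner_toLp]
      simp_rw [sq]
  have hbound (n : ℕ) : |c n ^ 2 * ρ ^ n| ≤ |ρ| ^ (k + 1) * c n ^ 2 := by
    rw [abs_mul, abs_pow ρ, abs_of_nonneg (sq_nonneg _), mul_comm]
    rcases Nat.lt_or_ge k n with hn | hn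
    · exact mul_le_mul_of_nonneg_right
        (pow_le_pow_of_le_one (abs_nonneg _) hρ hn) (sq_nonneg _)
    · simp [hc n hn]
  rw [abs_le]
  have h4 := h3.mul_left (|ρ| ^ (k + 1))
  exact ⟨hasSum_le (fun n ↦ (abs_le.1 (hbound n)).1) h4.neg h2,
    hasSum_le (fun n ↦ (abs_le.1 (hbound n)).2) h2 h4⟩

end Pair

/-! ### The standard Gaussian measure on a Euclidean space -/

section StdGaussian

variable {E : Type*} [NormedAddCommGroup E] [InnerProductSpace ℝ E] [FiniteDimensional ℝ E]
  [MeasurableSpace E] [BorelSpace E]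

lemma charFunDual_gaussianReal_zero_one (L : StrongDual ℝ ℝ) :
    charFunDual (gaussianReal 0 1) L = Complex.exp (-(L 1 : ℂ) ^ 2 / 2) := by
  rw [charFunDual_eq_charFun_map_one, gaussianReal_map_continuousLinearMap, charFun_gaussianReal]
  simp [Real.coe_toNNReal _ (sq_nonneg _), neg_div]

lemma measurePreserving_inner_stdGaussian {u : E} (hu : ‖u‖ = 1) :
    MeasurePreserving (fun x ↦ ⟪u, x⟫) (stdGaussian E) (gaussianReal 0 1) := by
  refine ⟨by fun_prop, Measure.ext_of_charFunDual (funext fun L ↦ ?_)⟩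
  change charFunDual ((stdGaussian E).map (innerSL ℝ u)) L = _
  have hL : L.comp (innerSL ℝ u) = innerSL ℝ (L 1 • u) := by
    ext x
    have := L.map_smul ⟪u, x⟫ 1
    simp only [smul_eq_mul, mul_one] at this
    simp [this, mul_comm]
  rw [charFunDual_map, hL, charFunDual_stdGaussian, charFunDual_gaussianReal_zero_one,
    innerSL_apply_norm, norm_smul, hu, mul_one]
  norm_cast
  rw [Real.norm_eq_abs, sq_abs]

lemma map_inner_prod_inner_stdGaussian {u v : E} (hu : ‖u‖ = 1) (hv : ‖v‖ = 1) :
    (stdGaussian E).map (fun x ↦ (⟪u, x⟫, ⟪v, x⟫)) =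
      ((gaussianReal 0 1).prod (gaussianReal 0 1)).map
        (fun z ↦ (z.1, ⟪u, v⟫ * z.1 + √(1 - ⟪u, v⟫ ^ 2) * z.2)) := by
  set ρ := ⟪u, v⟫ with hρ
  have hρ1 : |ρ| ≤ 1 := by simpa [hu, hv] using abs_real_inner_le_norm u v
  have hσ : √(1 - ρ ^ 2) ^ 2 = 1 - ρ ^ 2 := Real.sq_sqrt (by nlinarith [sq_abs ρ, abs_nonneg ρ])
  let T : E →L[ℝ] ℝ × ℝ := (innerSL ℝ u).prod (innerSL ℝ v)
  let S : ℝ × ℝ →L[ℝ] ℝ × ℝ := (ContinuousLinearMap.fst ℝ ℝ ℝ).prod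
    (ρ • ContinuousLinearMap.fst ℝ ℝ ℝ + √(1 - ρ ^ 2) • ContinuousLinearMap.snd ℝ ℝ ℝ)
  change (stdGaussian E).map T = ((gaussianReal 0 1).prod (gaussianReal 0 1)).map S
  refine Measure.ext_of_charFunDual (funext fun L ↦ ?_)
  have hLa (a b : ℝ) : L (a, b) = a * L (1, 0) + b * L (0, 1) := by
    have : ((a, b) : ℝ × ℝ) = a • (1, 0) + b • (0, 1) := by simp
    rw [this, map_add, map_smul, map_smul, smul_eq_mul, smul_eq_mul]
  have hL : L.comp T = innerSL ℝ (L (1, 0) • u + L (0, 1) • v) := by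
    ext x
    simp only [T, ContinuousLinearMap.comp_apply, ContinuousLinearMap.prod_apply,
      innerSL_apply_apply, inner_add_left, real_inner_smul_left]
    rw [hLa]; ring
  have hnorm : ‖L (1, 0) • u + L (0, 1) • v‖ ^ 2 =
      L (1, 0) ^ 2 + L (0, 1) ^ 2 + 2 * L (1, 0) * L (0, 1) * ρ := by
    rw [norm_add_sq_real, norm_smul, norm_smul, hu, hv, real_inner_smul_left,
      real_inner_smul_right, ← hρ]
    simp only [mul_one, Real.norm_eq_abs, sq_abs]
    ring
  have h1 : (L.comp S).comp (.inl ℝ ℝ ℝ) 1 = L (1, 0) + ρ * L (0, 1) := by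
    simp only [S, ContinuousLinearMap.comp_apply, ContinuousLinearMap.prod_apply]
    rw [hLa]; simp
  have h2 : (L.comp S).comp (.inr ℝ ℝ ℝ) 1 = √(1 - ρ ^ 2) * L (0, 1) := by
    simp only [S, ContinuousLinearMap.comp_apply, ContinuousLinearMap.prod_apply]
    rw [hLa]; simp
  rw [charFunDual_map, charFunDual_map, charFunDual_prod, hL, charFunDual_stdGaussian,
    innerSL_apply_norm, charFunDual_gaussianReal_zero_one, charFunDual_gaussianReal_zero_one,
    ← Complex.exp_add, h1, h2]
  norm_cast
  rw [hnorm, mul_pow, hσ]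
  congr 2
  ring

lemma isSteinPair_stdGaussian {u v : E} (hu : ‖u‖ = 1) (hv : ‖v‖ = 1) :
    IsSteinPair (stdGaussian E) (fun x ↦ ⟪u, x⟫) (fun x ↦ ⟪v, x⟫) ⟪u, v⟫ where
  left := measurePreserving_inner_stdGaussian hu
  right := measurePreserving_inner_stdGaussian hv
  stein p q := by
    have hlaw := map_inner_prod_inner_stdGaussian hu hv
    have hUm := measurePreserving_inner_stdGaussian hu
    have hVm := measurePreserving_inner_stdGaussian hv
    set ρ := ⟪u, v⟫
    set σ := √(1 - ρ ^ 2)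
    let W : ℝ × ℝ → ℝ := fun z ↦ ρ * z.1 + σ * z.2
    have hW : MeasurePreserving W ((gaussianReal 0 1).prod (gaussianReal 0 1))
        (gaussianReal 0 1) := by
      refine ⟨by fun_prop, ?_⟩
      have h := congrArg (Measure.map Prod.snd) hlaw
      rw [Measure.map_map (by fun_prop) (by fun_prop),
        Measure.map_map (by fun_prop) (by fun_prop)] at h
      exact h.symm.trans hVm.map_eq
    have hInt := integrable_comp_mul_comp_polynomial
      (measurePreserving_fst (μ := gaussianReal 0 1) (ν := gaussianReal 0 1)) hW
    have htrans (f g : ℝ[X]) : ∫ x, f.eval ⟪u, x⟫ * g.eval ⟪v, x⟫ ∂stdGaussian E =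
        ∫ y, ∫ x, f.eval x * g.eval (ρ * x + σ * y) ∂gaussianReal 0 1 ∂gaussianReal 0 1 := by
      have hfg : Continuous fun z : ℝ × ℝ ↦ f.eval z.1 * g.eval z.2 :=
        (f.continuous.comp continuous_fst).mul (g.continuous.comp continuous_snd)
      rw [← integral_prod_symm _ (hInt f g)]
      have h := congrArg (fun μ ↦ ∫ z, f.eval z.1 * g.eval z.2 ∂μ) hlaw
      rwa [integral_map (by fun_prop) hfg.aestronglyMeasurable,
        integral_map (by fun_prop) hfg.aestronglyMeasurable] at h
    have hX : (fun x ↦ ⟪u, x⟫ * p.eval ⟪u, x⟫ * q.eval ⟪v, x⟫) =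
        fun x ↦ (X * p).eval ⟪u, x⟫ * q.eval ⟪v, x⟫ := by
      ext x; simp
    rw [hX, htrans, htrans, htrans, ← integral_const_mul, ← integral_add
      (hInt (derivative p) q).integral_prod_right
      ((hInt p (derivative q)).integral_prod_right.const_mul ρ)]
    refine integral_congr_ae (Filter.Eventually.of_forall fun y ↦ ?_)
    have hs := integral_mul_polynomial_gaussianReal (p * q.comp (C ρ * X + C (σ * y)))
    have hi (f g : ℝ[X]) : Integrable (fun x ↦ f.eval x * g.eval (ρ * x + σ * y))
        (gaussianReal 0 1) := by
      refine (integrable_polynomial_gaussianReal (f * g.comp (C ρ * X + C (σ * y)))).congr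
        (Filter.Eventually.of_forall fun x ↦ ?_)
      simp
    simp only
    rw [← integral_const_mul, ← integral_add (hi _ _) ((hi _ _).const_mul _)]
    convert! hs using 3 with x x
    · simp [mul_assoc]
    · simp [derivative_comp]; ring

end StdGaussian

/-! ### Hidden-direction densities -/

section HiddenDirection

lemma gaussDensity_eq_gaussianPDFReal (z : ℝ) : gaussDensity z = gaussianPDFReal 0 1 z := by
  simp [gaussDensity, gaussianPDFReal, div_eq_inv_mul]

lemma gaussDensityPi_pos (d : ℕ) (x : EuclideanSpace ℝ (Fin d)) : 0 < gaussDensityPi d x := by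
  unfold gaussDensityPi; positivity

lemma continuous_gaussDensityPi (d : ℕ) : Continuous (gaussDensityPi d) := by
  unfold gaussDensityPi; fun_prop

lemma integrable_gaussDensityPi (d : ℕ) : Integrable (gaussDensityPi d) := by
  have h := GaussianFourier.integrable_cexp_neg_mul_sq_norm_add (b := 1 / 2) (by norm_num) 0
    (0 : EuclideanSpace ℝ (Fin d))
  refine (h.norm.div_const ((2 * π) ^ ((d : ℝ) / 2))).congr
    (Filter.Eventually.of_forall fun x ↦ ?_)
  simp only [gaussDensityPi, Complex.norm_exp]
  congr 2
  norm_cast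
  simp
  norm_cast
  ring

lemma withDensity_gaussDensityPi (d : ℕ) :
    (volume : Measure (EuclideanSpace ℝ (Fin d))).withDensity
      (fun x ↦ ENNReal.ofReal (gaussDensityPi d x)) =
      stdGaussian (EuclideanSpace ℝ (Fin d)) := by
  have := isFiniteMeasure_withDensity_ofReal (integrable_gaussDensityPi d).2
  have hm := (continuous_gaussDensityPi d).measurable
  refine Measure.ext_of_charFun (funext fun t ↦ ?_)
  rw [charFun_stdGaussian, charFun_apply,
    integral_withDensity_eq_integral_toReal_smul (by fun_prop) (by simp)]
  have h := GaussianFourier.integral_cexp_neg_mul_sq_norm_add (b := 1 / 2) (by norm_num) Complex.I t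
  have e (x : EuclideanSpace ℝ (Fin d)) :
      (ENNReal.ofReal (gaussDensityPi d x)).toReal • Complex.exp (⟪x, t⟫ * Complex.I) =
      (((2 * π) ^ ((d : ℝ) / 2) : ℝ) : ℂ)⁻¹ *
        Complex.exp (-(1 / 2) * ‖x‖ ^ 2 + Complex.I * ⟪t, x⟫) := by
    rw [ENNReal.toReal_ofReal (gaussDensityPi_pos d x).le, gaussDensityPi, Complex.real_smul,
      Complex.exp_add, real_inner_comm]
    push_cast
    ring_nf
  simp_rw [e]
  rw [integral_const_mul, h, Complex.ofReal_cpow (by positivity)]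
  have hne : ((2 : ℂ) * π) ^ ((d : ℂ) / 2) ≠ 0 := by
    rw [Complex.cpow_ne_zero_iff]; left; simp [Real.pi_ne_zero]
  push_cast
  rw [finrank_euclideanSpace_fin, show (π : ℂ) / (1 / 2) = 2 * π by ring,
    inv_mul_cancel_left₀ hne, Complex.I_sq]
  ring_nf

lemma integral_gaussDensityPi_mul (d : ℕ) (f : EuclideanSpace ℝ (Fin d) → ℝ) :
    ∫ x, gaussDensityPi d x * f x = ∫ x, f x ∂stdGaussian (EuclideanSpace ℝ (Fin d)) := by
  have hm := (continuous_gaussDensityPi d).measurable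
  rw [← withDensity_gaussDensityPi,
    integral_withDensity_eq_integral_toReal_smul (by fun_prop) (by simp)]
  simp [ENNReal.toReal_ofReal (gaussDensityPi_pos d _).le]

lemma hiddenDirDensity_eq (A : ℝ → ℝ) {d : ℕ} {u : EuclideanSpace ℝ (Fin d)} (hu : ‖u‖ = 1)
    (x : EuclideanSpace ℝ (Fin d)) :
    hiddenDirDensity A u x = A ⟪u, x⟫ / gaussianPDFReal 0 1 ⟪u, x⟫ * gaussDensityPi d x := by
  have hn : ‖x - ⟪u, x⟫ • u‖ ^ 2 = ‖x‖ ^ 2 - ⟪u, x⟫ ^ 2 := by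
    rw [norm_sub_sq_real, real_inner_smul_right, norm_smul, hu, real_inner_comm, mul_one,
      Real.norm_eq_abs, sq_abs]
    ring
  have hp : (2 * π) ^ ((d : ℝ) / 2) = (2 * π) ^ (((d : ℝ) - 1) / 2) * √(2 * π) := by
    rw [Real.sqrt_eq_rpow, ← Real.rpow_add (by positivity)]
    ring_nf
  have he : Real.exp (-(‖x‖ ^ 2 - ⟪u, x⟫ ^ 2) / 2) * Real.exp (-⟪u, x⟫ ^ 2 / 2) =
      Real.exp (-‖x‖ ^ 2 / 2) := by
    rw [← Real.exp_add]; ring_nf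
  rw [← gaussDensity_eq_gaussianPDFReal, hiddenDirDensity, gaussDensity, gaussDensityPi, hn, hp,
    ← he]
  field_simp

end HiddenDirection

/-! ### Likelihood ratios on the line -/

section LikelihoodRatio

lemma gaussianPDFReal_zero_one_pos (x : ℝ) : 0 < gaussianPDFReal 0 1 x :=
  gaussianPDFReal_pos _ _ _ one_ne_zero

lemma integral_mul_div_gaussianPDFReal (A f : ℝ → ℝ) :
    ∫ x, f x * (A x / gaussianPDFReal 0 1 x) ∂gaussianReal 0 1 = ∫ x, f x * A x := by
  rw [integral_gaussianReal_eq_integral_smul one_ne_zero]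
  refine integral_congr_ae (Filter.Eventually.of_forall fun x ↦ ?_)
  have := (gaussianPDFReal_zero_one_pos x).ne'
  simp only [smul_eq_mul]
  field_simp

lemma memLp_two_div_gaussianPDFReal {A : ℝ → ℝ} (hA : Measurable A)
    (hchi : Integrable fun z ↦ A z ^ 2 / gaussianPDFReal 0 1 z) :
    MemLp (fun z ↦ A z / gaussianPDFReal 0 1 z) 2 (gaussianReal 0 1) := by
  have hm : Measurable fun z ↦ A z / gaussianPDFReal 0 1 z :=
    hA.div (measurable_gaussianPDFReal 0 1)
  rw [memLp_two_iff_integrable_sq hm.aestronglyMeasurable, integrable_gaussianReal_iff]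
  refine hchi.congr (Filter.Eventually.of_forall fun x ↦ ?_)
  have := (gaussianPDFReal_zero_one_pos x).ne'
  simp only
  field_simp

lemma abs_integral_hiddenDirDensity_mul_sub_one_le {k d : ℕ} {A : ℝ → ℝ} (hA : Measurable A)
    (hprob : ∫ z, A z = 1)
    (hmom : ∀ t : ℕ, 1 ≤ t → t ≤ k → ∫ z, z ^ t * A z = ∫ z, z ^ t * gaussianPDFReal 0 1 z)
    (hchi : Integrable fun z ↦ A z ^ 2 / gaussianPDFReal 0 1 z)
    {u v : EuclideanSpace ℝ (Fin d)} (hu : ‖u‖ = 1) (hv : ‖v‖ = 1) :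
    |(∫ x, hiddenDirDensity A u x * hiddenDirDensity A v x / gaussDensityPi d x) - 1|
      ≤ |⟪u, v⟫| ^ (k + 1) * ((∫ z, A z ^ 2 / gaussianPDFReal 0 1 z) - 1) := by
  set g : ℝ → ℝ := fun z ↦ A z / gaussianPDFReal 0 1 z with hg
  have hg2 : MemLp g 2 (gaussianReal 0 1) := memLp_two_div_gaussianPDFReal hA hchi
  have hgi : Integrable g (gaussianReal 0 1) := hg2.integrable one_le_two
  have hg1 : ∫ x, g x ∂gaussianReal 0 1 = 1 := by
    simpa [hprob] using integral_mul_div_gaussianPDFReal A fun _ ↦ 1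
  have hgsq : ∫ x, g x ^ 2 ∂gaussianReal 0 1 = ∫ z, A z ^ 2 / gaussianPDFReal 0 1 z := by
    refine .trans ?_ ((integral_mul_div_gaussianPDFReal A g).trans ?_) <;> congr with x <;>
      simp only [hg] <;> ring
  have hh : MemLp (fun x ↦ g x - 1) 2 (gaussianReal 0 1) := hg2.sub (memLp_const 1)
  have hhsq : ∫ x, (g x - 1) ^ 2 ∂gaussianReal 0 1 =
      (∫ z, A z ^ 2 / gaussianPDFReal 0 1 z) - 1 := by
    have e (x : ℝ) : (g x - 1) ^ 2 = g x ^ 2 - (2 * g x - 1) := by ring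
    have h2 : Integrable (fun x ↦ 2 * g x - 1) (gaussianReal 0 1) :=
      (hgi.const_mul 2).sub (integrable_const 1)
    simp_rw [e]
    rw [integral_sub hg2.integrable_sq h2,
      integral_sub (hgi.const_mul 2) (integrable_const 1), integral_const_mul, hg1, hgsq]
    norm_num
  have hhmom (t : ℕ) (ht : t ≤ k) : ∫ x, x ^ t * (g x - 1) ∂gaussianReal 0 1 = 0 := by
    have hX : MemLp (fun x : ℝ ↦ x ^ t) 2 (gaussianReal 0 1) := by
      simpa using memLp_two_polynomial_gaussianReal (X ^ t)
    have hXg : Integrable (fun x ↦ x ^ t * g x) (gaussianReal 0 1) := hX.integrable_mul hg2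
    simp_rw [mul_sub, mul_one]
    rw [integral_sub hXg (hX.integrable one_le_two), sub_eq_zero]
    rcases Nat.eq_zero_or_pos t with rfl | ht0
    · simpa using hg1
    rw [hg, integral_mul_div_gaussianPDFReal, hmom t ht0 ht,
      integral_gaussianReal_eq_integral_smul one_ne_zero]
    simp [mul_comm]
  have hU := measurePreserving_inner_stdGaussian hu
  have hV := measurePreserving_inner_stdGaussian hv
  have hgU := hg2.comp_measurePreserving hU
  have hgV := hg2.comp_measurePreserving hV
  have hU1 : ∫ x, g ⟪u, x⟫ ∂stdGaussian (EuclideanSpace ℝ (Fin d)) = 1 := by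
    rw [← hg1, ← hU.map_eq, integral_map (by fun_prop) (by rw [hU.map_eq]; exact hgi.1)]
  have hV1 : ∫ x, g ⟪v, x⟫ ∂stdGaussian (EuclideanSpace ℝ (Fin d)) = 1 := by
    rw [← hg1, ← hV.map_eq, integral_map (by fun_prop) (by rw [hV.map_eq]; exact hgi.1)]
  have hcorr : (∫ x, hiddenDirDensity A u x * hiddenDirDensity A v x / gaussDensityPi d x) - 1 =
      ∫ x, (g ⟪u, x⟫ - 1) * (g ⟪v, x⟫ - 1) ∂stdGaussian (EuclideanSpace ℝ (Fin d)) := by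
    have e (x : EuclideanSpace ℝ (Fin d)) :
        hiddenDirDensity A u x * hiddenDirDensity A v x / gaussDensityPi d x =
        gaussDensityPi d x * (g ⟪u, x⟫ * g ⟪v, x⟫) := by
      have := (gaussDensityPi_pos d x).ne'
      rw [hiddenDirDensity_eq A hu, hiddenDirDensity_eq A hv, div_eq_iff this]
      ring
    have e2 (x : EuclideanSpace ℝ (Fin d)) : (g ⟪u, x⟫ - 1) * (g ⟪v, x⟫ - 1) =
        g ⟪u, x⟫ * g ⟪v, x⟫ - (g ⟪u, x⟫ + (g ⟪v, x⟫ - 1)) := by ring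
    have hgUi : Integrable (fun x ↦ g ⟪u, x⟫) (stdGaussian (EuclideanSpace ℝ (Fin d))) :=
      hgU.integrable one_le_two
    have hgVi : Integrable (fun x ↦ g ⟪v, x⟫) (stdGaussian (EuclideanSpace ℝ (Fin d))) :=
      hgV.integrable one_le_two
    have hgUV : Integrable (fun x ↦ g ⟪u, x⟫ * g ⟪v, x⟫)
        (stdGaussian (EuclideanSpace ℝ (Fin d))) := hgU.integrable_mul hgV
    have hgVi1 : Integrable (fun x ↦ g ⟪v, x⟫ - 1) (stdGaussian (EuclideanSpace ℝ (Fin d))) :=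
      hgVi.sub (integrable_const 1)
    have hgs : Integrable (fun x ↦ g ⟪u, x⟫ + (g ⟪v, x⟫ - 1))
        (stdGaussian (EuclideanSpace ℝ (Fin d))) := hgUi.add hgVi1
    simp_rw [e, e2]
    rw [integral_gaussDensityPi_mul, integral_sub hgUV hgs, integral_add hgUi hgVi1,
      integral_sub hgVi (integrable_const 1), hU1, hV1]
    simp
  have hρ : |⟪u, v⟫| ≤ 1 := by simpa [hu, hv] using abs_real_inner_le_norm u v
  rw [hcorr, ← hhsq]
  exact (isSteinPair_stdGaussian hu hv).abs_integral_mul_le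
    (real_inner_comm u v ▸ isSteinPair_stdGaussian hv hu) hρ hh hhmom

end LikelihoodRatio

end GaussianCorrelation

/-- If the density `A` matches the moments of degree `1, …, k` of `N(0,1)` and has finite
`χ²` divergence from `N(0,1)`, then for unit vectors `u, v` the pairwise correlation of
`P_u` and `P_v` relative to the standard Gaussian is bounded by
`|⟪u, v⟫|^(k+1) · χ²(A, N(0,1))`. -/
theorem stmt3 (k d : ℕ) (hk : 0 < k) (hd : 0 < d)
    (A : ℝ → ℝ) (hA_meas : Measurable A) (hA_nonneg : ∀ z, 0 ≤ A z)
    (hA_prob : ∫ z, A z = 1)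
    (hA_mom : ∀ t : ℕ, 1 ≤ t → t ≤ k → ∫ z, z ^ t * A z = ∫ z, z ^ t * gaussDensity z)
    (hchi : Integrable fun z => A z ^ 2 / gaussDensity z)
    (u v : EuclideanSpace ℝ (Fin d)) (hu : ‖u‖ = 1) (hv : ‖v‖ = 1) :
    |(∫ x, hiddenDirDensity A u x * hiddenDirDensity A v x / gaussDensityPi d x) - 1|
      ≤ |⟪u, v⟫| ^ (k + 1) * ((∫ z, A z ^ 2 / gaussDensity z) - 1) := by
  simp only [gaussDensity_eq_gaussianPDFReal] at hA_mom hchi ⊢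
  exact abs_integral_hiddenDirDensity_mul_sub_one_le hA_meas hA_prob hA_mom hchi hu hv
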